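/- arXiv:1905.09926 — 16 statements merged into one kernel-verified Lean document; each statement's English description precedes it below -/
import Mathlib

section
/- (Theorem 3.1) Let (Ob, R) be an approximation space, i.e. Ob a type with an equivalence relation R, and let B* = {(L X, M X) | X : Set Ob} ⊆ Set Ob × Set Ob be the collection of rough sets. Define on pairs: (A,B) ⊓ (C,D) = (A ∩ C, B ∩ D), (A,B) ⊔ (C,D) = (A ∪ C, B ∪ D), ∼(A,B) = (Bᶜ, Aᶜ), ∇(A,B) = (B, B), 0 = (∅, ∅), 1 = (Ob, Ob). Then: (i) B* contains 0 and 1 and is closed under ⊓, ⊔, ∼ and ∇ (in particular (L X ∩ L Y, M X ∩ M Y), (L X ∪ L Y, M X ∪ M Y), ((M X)ᶜ, (L X)ᶜ) and (M X, M X) are again of the form (L U, M U) for some U ⊆ Ob); and (ii) for all elements p, q of B*, the three-valued Łukasiewicz algebra axioms hold: ∼∼p = p, ∼(p ⊔ q) = ∼p ⊓ ∼q, ∼p ⊔ ∇p = 1, p ⊓ ∼p = ∼p ⊓ ∇p, and ∇(p ⊓ q) = ∇p ⊓ ∇q. Hence B* is a three-valued Łukasiewicz algebra. -/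
/-- A pair `(A, B)` is a rough set iff `A ⊆ B`, both are unions of equivalence classes, and
every singleton class contained in `B` is contained in `A`. -/
theorem exists_lower_upper_eq_iff {Ob : Type*} {R : Ob → Ob → Prop} (hR : Equivalence R)
    (A B : Set Ob) :
    (∃ X : Set Ob, A = {z | ∀ y, R z y → y ∈ X} ∧ B = {z | ∃ x ∈ X, R z x}) ↔
      A ⊆ B ∧ (∀ x y, R x y → x ∈ A → y ∈ A) ∧ (∀ x y, R x y → x ∈ B → y ∈ B) ∧
        ∀ z ∈ B, (∀ y, R z y → y = z) → z ∈ A := by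
  constructor
  · rintro ⟨X, rfl, rfl⟩
    refine ⟨fun z hz => ⟨z, hz z (hR.refl z), hR.refl z⟩,
      fun x y hxy hx w hyw => hx w (hR.trans hxy hyw), ?_, ?_⟩
    · rintro x y hxy ⟨w, hw, hxw⟩
      exact ⟨w, hw, hR.trans (hR.symm hxy) hxw⟩
    · rintro z ⟨x, hx, hzx⟩ hz y hzy
      rw [hz y hzy, ← hz x hzx]
      exact hx
  · rintro ⟨hAB, hA, hB, hsingle⟩
    let S : Setoid Ob := ⟨R, hR⟩
    let c : Ob → Ob := fun x => (Quotient.mk S x).out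
    have hc : ∀ x, R x (c x) := fun x => hR.symm (Quotient.mk_out (s := S) x)
    have hc_eq : ∀ x y, R x y → c x = c y := fun x y h =>
      congrArg Quotient.out (Quotient.sound (s := S) h)
    refine ⟨A ∪ {x | x ∈ B ∧ c x = x}, ?_, ?_⟩
    · ext z
      refine ⟨fun hz y hzy => Or.inl (hA z y hzy hz), fun hz => ?_⟩
      by_contra hzA
      have hfix : ∀ y, R z y → y ∈ B ∧ c y = y := fun y hzy =>
        (hz y hzy).resolve_left fun hy => hzA (hA y z (hR.symm hzy) hy)
      refine hzA (hsingle z (hfix z (hR.refl z)).1 fun y hzy => ?_)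
      rw [← (hfix y hzy).2, ← hc_eq z y hzy, (hfix z (hR.refl z)).2]
    · ext z
      constructor
      · exact fun hz => ⟨c z, Or.inr ⟨hB z _ (hc z) hz, (hc_eq z _ (hc z)).symm⟩, hc z⟩
      · rintro ⟨x, hx | hx, hzx⟩
        · exact hB x z (hR.symm hzx) (hAB hx)
        · exact hB x z (hR.symm hzx) hx.1


/-- Theorem 3.1: the collection `B*` of rough sets `(L X, M X)` of an approximation
space `(Ob, R)` is closed under the pair operations and satisfies the axioms of a
three-valued Łukasiewicz algebra. -/
theorem rough_sets_lukasiewicz {Ob : Type*} (R : Ob → Ob → Prop) (hR : Equivalence R)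
    (M L : Set Ob → Set Ob)
    (hM : ∀ A : Set Ob, M A = {z | ∃ x ∈ A, R z x})
    (hL : ∀ A : Set Ob, L A = {z | ∀ y, R z y → y ∈ A})
    (Bs : Set (Set Ob × Set Ob))
    (hBs : Bs = {p | ∃ X : Set Ob, p = (L X, M X)})
    (meet join : Set Ob × Set Ob → Set Ob × Set Ob → Set Ob × Set Ob)
    (neg nabla : Set Ob × Set Ob → Set Ob × Set Ob)
    (hmeet : ∀ p q : Set Ob × Set Ob, meet p q = (p.1 ∩ q.1, p.2 ∩ q.2))
    (hjoin : ∀ p q : Set Ob × Set Ob, join p q = (p.1 ∪ q.1, p.2 ∪ q.2))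
    (hneg : ∀ p : Set Ob × Set Ob, neg p = (p.2ᶜ, p.1ᶜ))
    (hnabla : ∀ p : Set Ob × Set Ob, nabla p = (p.2, p.2)) :
    -- (i) closure properties
    (((∅, ∅) : Set Ob × Set Ob) ∈ Bs ∧
     ((Set.univ, Set.univ) : Set Ob × Set Ob) ∈ Bs ∧
     (∀ p ∈ Bs, ∀ q ∈ Bs, meet p q ∈ Bs ∧ join p q ∈ Bs) ∧
     (∀ p ∈ Bs, neg p ∈ Bs ∧ nabla p ∈ Bs)) ∧
    -- (ii) three-valued Łukasiewicz algebra axioms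
    (∀ p ∈ Bs, ∀ q ∈ Bs,
      neg (neg p) = p ∧
      neg (join p q) = meet (neg p) (neg q) ∧
      join (neg p) (nabla p) = ((Set.univ, Set.univ) : Set Ob × Set Ob) ∧
      meet p (neg p) = meet (neg p) (nabla p) ∧
      nabla (meet p q) = meet (nabla p) (nabla q)) := by
  have mem_iff : ∀ A B : Set Ob, (A, B) ∈ Bs ↔
      A ⊆ B ∧ (∀ x y, R x y → x ∈ A → y ∈ A) ∧ (∀ x y, R x y → x ∈ B → y ∈ B) ∧
        ∀ z ∈ B, (∀ y, R z y → y = z) → z ∈ A := fun A B => by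
    rw [← exists_lower_upper_eq_iff hR A B, hBs]
    simp only [Set.mem_ofPred_eq, Prod.mk.injEq, hL, hM]
  refine ⟨⟨?_, ?_, ?_, ?_⟩, ?_⟩
  · simp [mem_iff]
  · simp [mem_iff]
  · rintro ⟨A, B⟩ hp ⟨C, D⟩ hq
    rw [mem_iff] at hp hq
    obtain ⟨hAB, hA, hB, hs⟩ := hp
    obtain ⟨hCD, hC, hD, ht⟩ := hq
    rw [hmeet, hjoin, mem_iff, mem_iff]
    exact ⟨⟨Set.inter_subset_inter hAB hCD,
        fun x y h hx => ⟨hA x y h hx.1, hC x y h hx.2⟩,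
        fun x y h hx => ⟨hB x y h hx.1, hD x y h hx.2⟩,
        fun z hz h => ⟨hs z hz.1 h, ht z hz.2 h⟩⟩,
      Set.union_subset_union hAB hCD,
        fun x y h hx => hx.imp (hA x y h) (hC x y h),
        fun x y h hx => hx.imp (hB x y h) (hD x y h),
        fun z hz h => hz.imp (fun hz => hs z hz h) fun hz => ht z hz h⟩
  · rintro ⟨A, B⟩ hp
    rw [mem_iff] at hp
    obtain ⟨hAB, hA, hB, hs⟩ := hp
    rw [hneg, hnabla, mem_iff, mem_iff]
    exact ⟨⟨Set.compl_subset_compl.2 hAB,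
        fun x y h hx hy => hx (hB y x (hR.symm h) hy),
        fun x y h hx hy => hx (hA y x (hR.symm h) hy),
        fun z hz h hzB => hz (hs z hzB h)⟩,
      subset_rfl, hB, hB, fun z hz _ => hz⟩
  · rintro ⟨A, B⟩ hp ⟨C, D⟩ -
    have hAB : A ⊆ B := ((mem_iff A B).1 hp).1
    have hdisj : A ∩ Bᶜ = ∅ := by
      rw [← Set.sdiff_eq, Set.sdiff_eq_empty]
      exact hAB
    have hcover : Aᶜ ∪ B = Set.univ := by
      rw [← compl_compl B, ← Set.compl_inter, hdisj, Set.compl_empty]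
    simp only [hmeet, hjoin, hneg, hnabla, compl_compl, Set.compl_union, Set.compl_union_self,
      Set.compl_inter_self, hdisj, hcover, Set.inter_comm B, and_self]
end

section
/- (Moisil construction) Let B be a Boolean algebra and let T = {(b₁, b₂) : B × B | b₁ ≤ b₂}, with componentwise meet and join, ∼(b₁, b₂) = (b₂ᶜ, b₁ᶜ), ∇(b₁, b₂) = (b₂, b₂), 0 = (⊥, ⊥), 1 = (⊤, ⊤). Then T is closed under these operations, and they satisfy the three-valued Łukasiewicz algebra axioms: ∼∼p = p, ∼(p ⊔ q) = ∼p ⊓ ∼q, ∼p ⊔ ∇p = 1, p ⊓ ∼p = ∼p ⊓ ∇p, ∇(p ⊓ q) = ∇p ⊓ ∇q; moreover the element c = (⊥, ⊤) is a center, i.e. ∼c = c, so T is a centered three-valued Łukasiewicz algebra (Post algebra of order 3). -/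
/-- The Moisil construction: pairs `(b₁, b₂)` with `b₁ ≤ b₂` in a Boolean algebra
form a centered three-valued Łukasiewicz algebra (Post algebra of order 3). -/
theorem moisil_construction {B : Type*} [BooleanAlgebra B]
    (T : Set (B × B)) (hT : T = {p | p.1 ≤ p.2})
    (meet join : B × B → B × B → B × B)
    (neg nabla : B × B → B × B)
    (hmeet : ∀ p q : B × B, meet p q = (p.1 ⊓ q.1, p.2 ⊓ q.2))
    (hjoin : ∀ p q : B × B, join p q = (p.1 ⊔ q.1, p.2 ⊔ q.2))
    (hneg : ∀ p : B × B, neg p = (p.2ᶜ, p.1ᶜ))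
    (hnabla : ∀ p : B × B, nabla p = (p.2, p.2)) :
    -- closure properties
    (((⊥, ⊥) : B × B) ∈ T ∧ ((⊤, ⊤) : B × B) ∈ T ∧
     (∀ p ∈ T, ∀ q ∈ T, meet p q ∈ T ∧ join p q ∈ T) ∧
     (∀ p ∈ T, neg p ∈ T ∧ nabla p ∈ T)) ∧
    -- three-valued Łukasiewicz algebra axioms
    (∀ p ∈ T, ∀ q ∈ T,
      neg (neg p) = p ∧
      neg (join p q) = meet (neg p) (neg q) ∧
      join (neg p) (nabla p) = ((⊤, ⊤) : B × B) ∧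
      meet p (neg p) = meet (neg p) (nabla p) ∧
      nabla (meet p q) = meet (nabla p) (nabla q)) ∧
    -- center
    (((⊥, ⊤) : B × B) ∈ T ∧ neg ((⊥, ⊤) : B × B) = ((⊥, ⊤) : B × B)) := by
  subst hT
  simp only [hmeet, hjoin, hneg, hnabla, Set.mem_ofPred_eq]
  refine ⟨⟨le_rfl, le_rfl, fun p hp q hq => ⟨inf_le_inf hp hq, sup_le_sup hp hq⟩,
    fun p hp => ⟨compl_le_compl hp, le_rfl⟩⟩, ?_, bot_le, by simp⟩
  intro p hp q _
  have h_inf : p.1 ⊓ p.2ᶜ = ⊥ := (disjoint_compl_right_iff.2 hp).eq_bot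
  have h_sup : p.1ᶜ ⊔ p.2 = ⊤ := by rw [sup_comm, ← himp_eq, himp_eq_top_iff.2 hp]
  exact ⟨by simp, by simp, by simp [h_sup], by simp [h_inf, inf_comm], trivial⟩
end

section
/- (Kleene law) Let A be a three-valued Łukasiewicz algebra, i.e. a bounded distributive lattice with unary operations ∼ and ∇ satisfying ∼∼x = x, ∼(x ⊔ y) = ∼x ⊓ ∼y, ∼x ⊔ ∇x = ⊤, x ⊓ ∼x = ∼x ⊓ ∇x, and ∇(x ⊓ y) = ∇x ⊓ ∇y. Then for all x, y ∈ A, x ⊓ ∼x ≤ y ⊔ ∼y. -/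
/-- Kleene law: in a three-valued Łukasiewicz algebra, `x ⊓ ∼x ≤ y ⊔ ∼y`. -/
theorem lukasiewicz_kleene_law {A : Type*} [DistribLattice A] [BoundedOrder A]
    (neg nabla : A → A)
    (hinv : ∀ x : A, neg (neg x) = x)
    (hdm : ∀ x y : A, neg (x ⊔ y) = neg x ⊓ neg y)
    (hax1 : ∀ x : A, neg x ⊔ nabla x = ⊤)
    (hax2 : ∀ x : A, x ⊓ neg x = neg x ⊓ nabla x)
    (hax3 : ∀ x y : A, nabla (x ⊓ y) = nabla x ⊓ nabla y) :
    ∀ x y : A, x ⊓ neg x ≤ y ⊔ neg y := by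
  intro x y
  have le_nabla : ∀ z : A, z ≤ nabla z := fun z => by
    calc z = z ⊓ (neg z ⊔ nabla z) := by rw [hax1, inf_top_eq]
      _ = neg z ⊓ nabla z ⊔ z ⊓ nabla z := by rw [inf_sup_left, hax2]
      _ ≤ nabla z := sup_le inf_le_right inf_le_right
  have neg_anti : ∀ u v : A, u ≤ v → neg v ≤ neg u := fun u v h => by
    rw [← sup_eq_right.mpr h, hdm]
    exact inf_le_left
  have neg_inf : neg (x ⊓ neg x) = x ⊔ neg x := by
    rw [← hinv (x ⊔ neg x), hdm, hinv, inf_comm]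
  have nabla_top : nabla (y ⊔ neg y) = ⊤ := by
    rw [← hax1 (y ⊔ neg y), eq_comm, sup_eq_right, hdm]
    exact (inf_le_left.trans le_sup_right).trans (le_nabla _)
  generalize y ⊔ neg y = b at nabla_top ⊢
  have le_neg : x ⊓ neg x ≤ neg (x ⊓ neg x) := by
    rw [neg_inf]
    exact inf_le_left.trans le_sup_left
  generalize x ⊓ neg x = a at le_neg ⊢
  have nabla_inf : nabla (a ⊓ b) = nabla a := by
    rw [hax3, nabla_top, inf_top_eq]
  -- Since `∇(a ⊓ b) = ∇a`, the second axiom at `a ⊓ b` bounds `a` by `a ⊓ b`.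
  calc a ≤ neg (a ⊓ b) ⊓ nabla (a ⊓ b) :=
        le_inf (le_neg.trans (neg_anti _ _ inf_le_left)) (nabla_inf ▸ le_nabla a)
    _ = (a ⊓ b) ⊓ neg (a ⊓ b) := (hax2 _).symm
    _ ≤ b := inf_le_left.trans inf_le_right
end

section
/- (Moisil determination principle) Let A be a three-valued Łukasiewicz algebra and define △x = ∼∇∼x. If x, y ∈ A satisfy ∇x = ∇y and △x = △y, then x = y. -/
/-- Moisil determination principle: in a three-valued Łukasiewicz algebra, with
`△x = ∼∇∼x`, if `∇x = ∇y` and `△x = △y` then `x = y`. -/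
theorem moisil_determination {A : Type*} [DistribLattice A] [BoundedOrder A]
    (neg nabla : A → A)
    (hinv : ∀ x : A, neg (neg x) = x)
    (hdm : ∀ x y : A, neg (x ⊔ y) = neg x ⊓ neg y)
    (hax1 : ∀ x : A, neg x ⊔ nabla x = ⊤)
    (hax2 : ∀ x : A, x ⊓ neg x = neg x ⊓ nabla x)
    (hax3 : ∀ x y : A, nabla (x ⊓ y) = nabla x ⊓ nabla y)
    (x y : A)
    (hnab : nabla x = nabla y)
    (hnec : neg (nabla (neg x)) = neg (nabla (neg y))) :
    x = y := by
  have hm : nabla (neg x) = nabla (neg y) := by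
    rw [← hinv (nabla (neg x)), hnec, hinv]
  have h_anti : ∀ a b : A, a ≤ b → neg b ≤ neg a := by
    intro a b hab
    rw [← sup_eq_right.mpr hab, hdm]
    exact inf_le_left
  have h_inf : ∀ a : A, a ⊓ nabla (neg a) = neg a ⊓ nabla a := by
    intro a
    rw [← hax2 a]
    simpa [hinv, inf_comm] using (hax2 (neg a)).symm
  have h_sup : ∀ a : A, a ⊔ nabla (neg a) = ⊤ := by
    intro a
    simpa [hinv] using hax1 (neg a)
  have h_le : ∀ a b : A, nabla a = nabla b → neg b ⊓ nabla b ≤ a := by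
    intro a b hab
    have h_nabla : nabla (a ⊓ b) = nabla b := by rw [hax3, hab, inf_idem]
    calc
      neg b ⊓ nabla b ≤ neg (a ⊓ b) ⊓ nabla (a ⊓ b) := by
        rw [h_nabla]
        exact inf_le_inf_right _ (h_anti _ _ inf_le_right)
      _ = (a ⊓ b) ⊓ neg (a ⊓ b) := (hax2 _).symm
      _ ≤ a := inf_le_left.trans inf_le_left
  refine eq_of_inf_eq_sup_eq (a := nabla (neg x)) (le_antisymm ?_ ?_) ?_
  · refine le_inf ?_ inf_le_right
    rw [h_inf]
    exact h_le y x hnab.symm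
  · refine le_inf ?_ inf_le_right
    rw [hm, h_inf]
    exact h_le x y hnab
  · rw [h_sup, hm, h_sup]
end

section
/- Let A be a three-valued Łukasiewicz algebra. Define x ⇒ y = ∼∇x ⊔ y ⊔ (∇∼x ⊓ ∇y). Then ⇒ is a relative pseudocomplement: for all x, y, z ∈ A, z ⊓ x ≤ y if and only if z ≤ x ⇒ y. Hence every three-valued Łukasiewicz algebra is a Heyting algebra. -/
/-- Every three-valued Łukasiewicz algebra is a Heyting algebra:
`x ⇒ y = ∼∇x ⊔ y ⊔ (∇∼x ⊓ ∇y)` is a relative pseudocomplement. -/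
theorem lukasiewicz_heyting {A : Type*} [DistribLattice A] [BoundedOrder A]
    (neg nabla : A → A)
    (hinv : ∀ x : A, neg (neg x) = x)
    (hdm : ∀ x y : A, neg (x ⊔ y) = neg x ⊓ neg y)
    (hax1 : ∀ x : A, neg x ⊔ nabla x = ⊤)
    (hax2 : ∀ x : A, x ⊓ neg x = neg x ⊓ nabla x)
    (hax3 : ∀ x y : A, nabla (x ⊓ y) = nabla x ⊓ nabla y)
    (imp : A → A → A)
    (himp : ∀ x y : A, imp x y = neg (nabla x) ⊔ y ⊔ (nabla (neg x) ⊓ nabla y)) :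
    ∀ x y z : A, z ⊓ x ≤ y ↔ z ≤ imp x y := by
  have neg_anti : ∀ {a b : A}, a ≤ b → neg b ≤ neg a := fun {a b} h => by
    rw [← sup_eq_right.mpr h, hdm]
    exact inf_le_left
  have nabla_mono : ∀ {a b : A}, a ≤ b → nabla a ≤ nabla b := fun {a b} h => by
    rw [← inf_eq_left.mpr h, hax3]
    exact inf_le_right
  have neg_bot : neg ⊥ = ⊤ := top_le_iff.mp (by
    simpa only [hinv] using neg_anti (bot_le : ⊥ ≤ neg ⊤))
  have neg_top : neg ⊤ = ⊥ := by rw [← neg_bot, hinv]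
  have nabla_bot : nabla ⊥ = ⊥ := by simpa [neg_bot] using (hax2 ⊥).symm
  have le_nabla : ∀ a : A, a ≤ nabla a := fun a =>
    calc a = a ⊓ (neg a ⊔ nabla a) := by rw [hax1, inf_top_eq]
      _ = a ⊓ neg a ⊔ a ⊓ nabla a := inf_sup_left _ _ _
      _ ≤ nabla a := sup_le ((hax2 a).le.trans inf_le_right) inf_le_right
  have inf_neg_nabla : ∀ a : A, a ⊓ neg (nabla a) = ⊥ := fun a => by
    rw [← neg_top, ← hax1 a, hdm, hinv]
  have nabla_inf_neg : ∀ a : A, nabla a ⊓ neg (nabla a) = ⊥ := fun a =>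
    le_bot_iff.mp <| calc
      nabla a ⊓ neg (nabla a) ≤ nabla a ⊓ nabla (neg (nabla a)) :=
        inf_le_inf_left _ (le_nabla _)
      _ = ⊥ := by rw [← hax3, inf_neg_nabla, nabla_bot]
  have nabla_sup_neg : ∀ a : A, neg (nabla a) ⊔ nabla a = ⊤ := fun a => by
    rw [← hinv (neg (nabla a) ⊔ nabla a), hdm, hinv, nabla_inf_neg, neg_bot]
  intro x y z
  rw [himp]
  constructor
  · intro h
    have hz : z ⊓ nabla x ≤ nabla y :=
      (inf_le_inf_right _ (le_nabla z)).trans (by rw [← hax3]; exact nabla_mono h)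
    have htop : x ⊔ nabla (neg x) = ⊤ := by simpa only [hinv] using hax1 (neg x)
    calc z = z ⊓ x ⊔ z ⊓ nabla (neg x) := by rw [← inf_sup_left, htop, inf_top_eq]
      _ = z ⊓ x ⊔ (z ⊓ nabla (neg x) ⊓ neg (nabla x) ⊔ z ⊓ nabla (neg x) ⊓ nabla x) := by
        rw [← inf_sup_left (z ⊓ nabla (neg x)), nabla_sup_neg, inf_top_eq]
      _ ≤ neg (nabla x) ⊔ y ⊔ (nabla (neg x) ⊓ nabla y) := by
        refine sup_le (h.trans (le_sup_right.trans le_sup_left))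
          (sup_le (inf_le_right.trans (le_sup_left.trans le_sup_left))
            (le_trans (le_inf ?_ ?_) le_sup_right))
        · exact inf_le_left.trans inf_le_right
        · exact (inf_le_inf_right _ inf_le_left).trans hz
  · intro h
    have hcore : x ⊓ (nabla (neg x) ⊓ nabla y) ≤ y := by
      have hx : x ⊓ nabla (neg x) = x ⊓ neg x := by
        simpa only [hinv, inf_comm (neg x) x] using (hax2 (neg x)).symm
      rw [← inf_assoc, hx]
      set p := x ⊓ neg x
      have hp : p ≤ neg p := (inf_le_right : p ≤ neg x).trans (neg_anti inf_le_left)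
      calc p ⊓ nabla y ≤ neg (p ⊓ y) ⊓ nabla (p ⊓ y) := by
            rw [hax3]
            exact le_inf (inf_le_left.trans (hp.trans (neg_anti inf_le_left)))
              (inf_le_inf_right _ (le_nabla p))
        _ = p ⊓ y ⊓ neg (p ⊓ y) := (hax2 _).symm
        _ ≤ y := inf_le_left.trans inf_le_right
    calc z ⊓ x ≤ x ⊓ (neg (nabla x) ⊔ y ⊔ (nabla (neg x) ⊓ nabla y)) :=
          le_inf inf_le_right (inf_le_left.trans h)
      _ ≤ y := by
        rw [inf_sup_left, inf_sup_left, inf_neg_nabla]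
        exact sup_le (sup_le bot_le inf_le_right) hcore
end

section
/- (Lemma 3.1) Let A be a three-valued Łukasiewicz algebra, P a prime filter of A, and g(P) = {x | ∼x ∉ P}. If g(P) ⊆ P and ∇x ∈ P, then x ∈ P. -/
/-- Lemma 3.1: if `P` is a prime filter of a three-valued Łukasiewicz algebra with
`g(P) = {x | ∼x ∉ P} ⊆ P` and `∇x ∈ P`, then `x ∈ P`. -/
theorem lukasiewicz_lemma31 {A : Type*} [DistribLattice A] [BoundedOrder A]
    (neg nabla : A → A)
    (hinv : ∀ x : A, neg (neg x) = x)
    (hdm : ∀ x y : A, neg (x ⊔ y) = neg x ⊓ neg y)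
    (hax1 : ∀ x : A, neg x ⊔ nabla x = ⊤)
    (hax2 : ∀ x : A, x ⊓ neg x = neg x ⊓ nabla x)
    (hax3 : ∀ x y : A, nabla (x ⊓ y) = nabla x ⊓ nabla y)
    (P : Set A)
    (hne : P.Nonempty) (hproper : P ≠ Set.univ)
    (hup : ∀ x ∈ P, ∀ y : A, x ≤ y → y ∈ P)
    (hinf : ∀ x ∈ P, ∀ y ∈ P, x ⊓ y ∈ P)
    (hprime : ∀ x y : A, x ⊔ y ∈ P → x ∈ P ∨ y ∈ P)
    (hgP : {x : A | neg x ∉ P} ⊆ P)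
    (x : A) (hx : nabla x ∈ P) :
    x ∈ P := by
  by_cases h : neg x ∈ P
  · have h_inf := hinf _ h _ hx
    rw [← hax2] at h_inf
    exact hup _ h_inf _ inf_le_left
  · exact hgP h
end

section
/- (Lemma 3.2) Let A be a three-valued Łukasiewicz algebra, P a prime filter of A, g(P) = {x | ∼x ∉ P}, and △x = ∼∇∼x. If g(P) ⊆ P and x ∈ g(P), then △x ∈ g(P). -/
/-- Lemma 3.2: if `P` is a prime filter of a three-valued Łukasiewicz algebra with
`g(P) = {x | ∼x ∉ P} ⊆ P` and `x ∈ g(P)`, then `△x = ∼∇∼x ∈ g(P)`. -/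
theorem lukasiewicz_lemma32 {A : Type*} [DistribLattice A] [BoundedOrder A]
    (neg nabla : A → A)
    (hinv : ∀ x : A, neg (neg x) = x)
    (hdm : ∀ x y : A, neg (x ⊔ y) = neg x ⊓ neg y)
    (hax1 : ∀ x : A, neg x ⊔ nabla x = ⊤)
    (hax2 : ∀ x : A, x ⊓ neg x = neg x ⊓ nabla x)
    (hax3 : ∀ x y : A, nabla (x ⊓ y) = nabla x ⊓ nabla y)
    (P : Set A)
    (hne : P.Nonempty) (hproper : P ≠ Set.univ)
    (hup : ∀ x ∈ P, ∀ y : A, x ≤ y → y ∈ P)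
    (hinf : ∀ x ∈ P, ∀ y ∈ P, x ⊓ y ∈ P)
    (hprime : ∀ x y : A, x ⊔ y ∈ P → x ∈ P ∨ y ∈ P)
    (hgP : {x : A | neg x ∉ P} ⊆ P)
    (x : A) (hx : x ∈ {x : A | neg x ∉ P}) :
    neg (nabla (neg x)) ∈ {x : A | neg x ∉ P} := by
  have hxP : x ∈ P := hgP hx
  have h := hax2 (neg x)
  rw [hinv] at h
  rw [Set.mem_ofPred_eq, hinv]
  intro hn
  exact hx (hup _ (h ▸ hinf _ hxP _ hn) _ inf_le_left)
end

section
/- Let A be a three-valued Łukasiewicz algebra. Then: (i) for every prime filter P of A, P and g(P) = {x | ∼x ∉ P} are comparable, i.e. P ⊆ g(P) or g(P) ⊆ P; and (ii) the set of prime filters of A, ordered by inclusion, contains no three-element chain: there are no prime filters P, Q, S with P ⊊ Q ⊊ S. Consequently the relation 'P and Q are comparable under inclusion' is an equivalence relation on the set of prime filters of A. -/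
/-- A prime filter of a bounded distributive lattice: a proper nonempty subset,
upward closed, closed under `⊓`, and prime with respect to `⊔`. -/
def IsPrimeFilter {A : Type*} [DistribLattice A] [BoundedOrder A] (P : Set A) : Prop :=
  P.Nonempty ∧ P ≠ Set.univ ∧ (∀ x ∈ P, ∀ y : A, x ≤ y → y ∈ P) ∧
    (∀ x ∈ P, ∀ y ∈ P, x ⊓ y ∈ P) ∧ (∀ x y : A, x ⊔ y ∈ P → x ∈ P ∨ y ∈ P)

theorem neg_inf_of_involution {A : Type*} [Lattice A] {neg : A → A}
    (hinv : ∀ x : A, neg (neg x) = x)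
    (hdm : ∀ x y : A, neg (x ⊔ y) = neg x ⊓ neg y) (x y : A) :
    neg (x ⊓ y) = neg x ⊔ neg y := by
  rw [← hinv (neg x ⊔ neg y), hdm, hinv, hinv]

section

variable {A : Type*} [DistribLattice A] [BoundedOrder A] {neg nabla : A → A} {P Q : Set A}

theorem IsPrimeFilter.inf_mem_iff (hP : IsPrimeFilter P) {x y : A} :
    x ⊓ y ∈ P ↔ x ∈ P ∧ y ∈ P :=
  ⟨fun h => ⟨hP.2.2.1 _ h _ inf_le_left, hP.2.2.1 _ h _ inf_le_right⟩,
    fun h => hP.2.2.2.1 _ h.1 _ h.2⟩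

theorem IsPrimeFilter.sup_mem_iff (hP : IsPrimeFilter P) {x y : A} :
    x ⊔ y ∈ P ↔ x ∈ P ∨ y ∈ P :=
  ⟨hP.2.2.2.2 x y, fun h => h.elim (fun h => hP.2.2.1 _ h _ le_sup_left)
    (fun h => hP.2.2.1 _ h _ le_sup_right)⟩

theorem IsPrimeFilter.top_mem (hP : IsPrimeFilter P) : ⊤ ∈ P := by
  obtain ⟨x, hx⟩ := hP.1
  exact hP.2.2.1 x hx _ le_top

/-- The Białynicki-Birula–Rasiowa transform of a prime filter is a prime filter. -/
theorem IsPrimeFilter.transform (hinv : ∀ x : A, neg (neg x) = x)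
    (hdm : ∀ x y : A, neg (x ⊔ y) = neg x ⊓ neg y) (hP : IsPrimeFilter P) :
    IsPrimeFilter {x : A | neg x ∉ P} := by
  have hinf := neg_inf_of_involution hinv hdm
  refine ⟨?_, ?_, fun x hx y hxy hy => hx ?_, fun x hx y hy => ?_, fun x y hxy => ?_⟩
  · obtain ⟨x, hx⟩ := (Set.ne_univ_iff_exists_notMem P).1 hP.2.1
    exact ⟨neg x, by simpa [hinv] using hx⟩
  · obtain ⟨x, hx⟩ := hP.1
    exact (Set.ne_univ_iff_exists_notMem _).2 ⟨neg x, by simpa [hinv] using hx⟩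
  · rw [← sup_eq_right.2 hxy, hdm] at hy
    exact (hP.inf_mem_iff.1 hy).1
  · simp only [Set.mem_ofPred_eq, hinf, hP.sup_mem_iff] at *
    tauto
  · simp only [Set.mem_ofPred_eq, hdm, hP.inf_mem_iff] at *
    tauto

theorem IsPrimeFilter.nabla_mem_iff (hax1 : ∀ x : A, neg x ⊔ nabla x = ⊤)
    (hax2 : ∀ x : A, x ⊓ neg x = neg x ⊓ nabla x) (hP : IsPrimeFilter P) (x : A) :
    nabla x ∈ P ↔ x ∈ P ∨ neg x ∉ P := by
  have h1 : neg x ∈ P ∨ nabla x ∈ P := hP.sup_mem_iff.1 (hax1 x ▸ hP.top_mem)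
  have h2 : x ∈ P ∧ neg x ∈ P ↔ neg x ∈ P ∧ nabla x ∈ P := by
    rw [← hP.inf_mem_iff, hax2, hP.inf_mem_iff]
  tauto

theorem IsPrimeFilter.neg_nabla_mem_iff (hinv : ∀ x : A, neg (neg x) = x)
    (hdm : ∀ x y : A, neg (x ⊔ y) = neg x ⊓ neg y)
    (hax1 : ∀ x : A, neg x ⊔ nabla x = ⊤)
    (hax2 : ∀ x : A, x ⊓ neg x = neg x ⊓ nabla x) (hP : IsPrimeFilter P) (x : A) :
    neg (nabla x) ∈ P ↔ nabla x ∉ P := by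
  have h1 := hP.nabla_mem_iff hax1 hax2 x
  have h2 := (hP.transform hinv hdm).nabla_mem_iff hax1 hax2 x
  simp only [Set.mem_ofPred_eq, hinv] at h2
  tauto

theorem IsPrimeFilter.comparable_transform (hinv : ∀ x : A, neg (neg x) = x)
    (hdm : ∀ x y : A, neg (x ⊔ y) = neg x ⊓ neg y)
    (hax1 : ∀ x : A, neg x ⊔ nabla x = ⊤)
    (hax2 : ∀ x : A, x ⊓ neg x = neg x ⊓ nabla x)
    (hax3 : ∀ x y : A, nabla (x ⊓ y) = nabla x ⊓ nabla y) (hP : IsPrimeFilter P) :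
    P ⊆ {x : A | neg x ∉ P} ∨ {x : A | neg x ∉ P} ⊆ P := by
  by_contra! h
  obtain ⟨x, hx, hx'⟩ := Set.not_subset.1 h.1
  obtain ⟨y, hy, hy'⟩ := Set.not_subset.1 h.2
  have hxy := hP.nabla_mem_iff hax1 hax2 (x ⊓ y)
  rw [hax3, hP.inf_mem_iff, hP.inf_mem_iff, hP.nabla_mem_iff hax1 hax2,
    hP.nabla_mem_iff hax1 hax2, neg_inf_of_involution hinv hdm, hP.sup_mem_iff] at hxy
  simp only [Set.mem_ofPred_eq] at hx' hy
  tauto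

theorem IsPrimeFilter.nabla_mem_iff_of_subset (hinv : ∀ x : A, neg (neg x) = x)
    (hdm : ∀ x y : A, neg (x ⊔ y) = neg x ⊓ neg y)
    (hax1 : ∀ x : A, neg x ⊔ nabla x = ⊤)
    (hax2 : ∀ x : A, x ⊓ neg x = neg x ⊓ nabla x)
    (hP : IsPrimeFilter P) (hQ : IsPrimeFilter Q) (h : P ⊆ Q) (x : A) :
    nabla x ∈ P ↔ nabla x ∈ Q := by
  have h1 := hP.neg_nabla_mem_iff hinv hdm hax1 hax2 x
  have h2 := hQ.neg_nabla_mem_iff hinv hdm hax1 hax2 x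
  have h3 := @h (nabla x)
  have h4 := @h (neg (nabla x))
  tauto

/-- Prime filters containing the same elements of the form `∇x` agree up to the transform. -/
theorem IsPrimeFilter.eq_or_eq_transform (hinv : ∀ x : A, neg (neg x) = x)
    (hdm : ∀ x y : A, neg (x ⊔ y) = neg x ⊓ neg y)
    (hax1 : ∀ x : A, neg x ⊔ nabla x = ⊤)
    (hax2 : ∀ x : A, x ⊓ neg x = neg x ⊓ nabla x)
    (hax3 : ∀ x y : A, nabla (x ⊓ y) = nabla x ⊓ nabla y)
    (hP : IsPrimeFilter P) (hQ : IsPrimeFilter Q)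
    (h : ∀ x, nabla x ∈ P ↔ nabla x ∈ Q) : Q = P ∨ Q = {x : A | neg x ∉ P} := by
  have key (x : A) : (x ∈ P ∨ neg x ∉ P) ↔ (x ∈ Q ∨ neg x ∉ Q) := by
    rw [← hP.nabla_mem_iff hax1 hax2, ← hQ.nabla_mem_iff hax1 hax2, h]
  have key' (x : A) : (neg x ∈ P ∨ x ∉ P) ↔ (neg x ∈ Q ∨ x ∉ Q) := by
    simpa only [hinv] using key (neg x)
  rcases hP.comparable_transform hinv hdm hax1 hax2 hax3 with hp | hp <;>
  rcases hQ.comparable_transform hinv hdm hax1 hax2 hax3 with hq | hq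
  on_goal 1 => left
  on_goal 2 => right
  on_goal 3 => right
  on_goal 4 => left
  all_goals
    ext x
    have hpx := @hp x
    have hqx := @hq x
    have hx := key x
    have hx' := key' x
    simp only [Set.mem_ofPred_eq] at *
    tauto

end

/-- In a three-valued Łukasiewicz algebra: (i) every prime filter `P` is comparable
with `g(P) = {x | ∼x ∉ P}`; (ii) there is no three-element chain of prime filters;
consequently comparability is an equivalence relation on the prime filters. -/
theorem lukasiewicz_prime_filters_comparability {A : Type*}
    [DistribLattice A] [BoundedOrder A]
    (neg nabla : A → A)
    (hinv : ∀ x : A, neg (neg x) = x)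
    (hdm : ∀ x y : A, neg (x ⊔ y) = neg x ⊓ neg y)
    (hax1 : ∀ x : A, neg x ⊔ nabla x = ⊤)
    (hax2 : ∀ x : A, x ⊓ neg x = neg x ⊓ nabla x)
    (hax3 : ∀ x y : A, nabla (x ⊓ y) = nabla x ⊓ nabla y) :
    (∀ P : Set A, IsPrimeFilter P →
      P ⊆ {x : A | neg x ∉ P} ∨ {x : A | neg x ∉ P} ⊆ P) ∧
    (¬ ∃ P Q S : Set A, IsPrimeFilter P ∧ IsPrimeFilter Q ∧ IsPrimeFilter S ∧
      P ⊂ Q ∧ Q ⊂ S) ∧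
    Equivalence (fun P Q : {P : Set A // IsPrimeFilter P} => P.1 ⊆ Q.1 ∨ Q.1 ⊆ P.1) := by
  have hsub {P Q : Set A} (hP : IsPrimeFilter P) (hQ : IsPrimeFilter Q)
      (h : P ⊆ Q ∨ Q ⊆ P) (x : A) : nabla x ∈ P ↔ nabla x ∈ Q :=
    h.elim (fun h => hP.nabla_mem_iff_of_subset hinv hdm hax1 hax2 hQ h x)
      (fun h => (hQ.nabla_mem_iff_of_subset hinv hdm hax1 hax2 hP h x).symm)
  refine ⟨fun P hP => hP.comparable_transform hinv hdm hax1 hax2 hax3, ?_,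
    fun P => Or.inl subset_rfl, fun h => h.symm, fun {P Q S} hPQ hQS => ?_⟩
  · rintro ⟨P, Q, S, hP, hQ, hS, hPQ, hQS⟩
    have h1 := hP.eq_or_eq_transform hinv hdm hax1 hax2 hax3 hQ (hsub hP hQ (Or.inl hPQ.subset))
    have h2 := hP.eq_or_eq_transform hinv hdm hax1 hax2 hax3 hS
      (hsub hP hS (Or.inl (hPQ.trans hQS).subset))
    have hQ' := h1.resolve_left hPQ.ne'
    have hS' := h2.resolve_left (hPQ.trans hQS).ne'
    exact hQS.ne (hQ'.trans hS'.symm)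
  · rcases P.2.eq_or_eq_transform hinv hdm hax1 hax2 hax3 S.2
      (fun x => (hsub P.2 Q.2 hPQ x).trans (hsub Q.2 S.2 hQS x)) with h | h
    · exact Or.inl h.ge
    · rw [h]
      exact P.2.comparable_transform hinv hdm hax1 hax2 hax3
end

section
/- (Claim (1) in the proof of Theorem 3.2) Let A be a three-valued Łukasiewicz algebra, Ob the set of prime filters of A, R the comparability relation on Ob (P R Q iff P ⊆ Q or Q ⊆ P), M X = {P ∈ Ob | ∃ Q ∈ X, P R Q} for X ⊆ Ob, and s(x) = {P ∈ Ob | x ∈ P} the Stone map. Then for every x ∈ A, M s(∇x) = s(∇x). -/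
namespace IsPrimeFilter

variable {A : Type*} [DistribLattice A] [BoundedOrder A] {P Q : Set A}

theorem top_mem_s10 (hP : IsPrimeFilter P) : ⊤ ∈ P :=
  let ⟨x, hx⟩ := hP.1
  hP.2.2.1 x hx ⊤ le_top

theorem bot_notMem (hP : IsPrimeFilter P) : ⊥ ∉ P := fun h =>
  hP.2.1 (Set.eq_univ_of_forall fun x => hP.2.2.1 ⊥ h x bot_le)

/-- Comparable prime filters contain the same complemented elements. -/
theorem mem_iff_mem_of_subset (hP : IsPrimeFilter P) (hQ : IsPrimeFilter Q) (h : P ⊆ Q)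
    {c d : A} (hcd : IsCompl c d) : c ∈ P ↔ c ∈ Q := by
  refine ⟨fun hc => h hc, fun hc => ?_⟩
  refine (hP.2.2.2.2 c d (hcd.sup_eq_top ▸ hP.top_mem_s10)).resolve_right fun hd => ?_
  exact hQ.bot_notMem (hcd.inf_eq_bot ▸ hQ.2.2.2.1 c hc d (h hd))

end IsPrimeFilter

/-- In a three-valued Łukasiewicz algebra, `∇x` is complemented by `∼∇x`. -/
theorem isCompl_nabla_neg_nabla {A : Type*} [DistribLattice A] [BoundedOrder A]
    (neg nabla : A → A)
    (hinv : ∀ x : A, neg (neg x) = x)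
    (hdm : ∀ x y : A, neg (x ⊔ y) = neg x ⊓ neg y)
    (hax1 : ∀ x : A, neg x ⊔ nabla x = ⊤)
    (hax2 : ∀ x : A, x ⊓ neg x = neg x ⊓ nabla x)
    (hax3 : ∀ x y : A, nabla (x ⊓ y) = nabla x ⊓ nabla y) (x : A) :
    IsCompl (nabla x) (neg (nabla x)) := by
  have neg_top : neg ⊤ = ⊥ := by
    have h := hdm ⊤ (neg ⊥)
    rwa [top_sup_eq, hinv, inf_bot_eq] at h
  have le_nabla : x ≤ nabla x := by
    calc x = x ⊓ (neg x ⊔ nabla x) := by rw [hax1, inf_top_eq]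
      _ = (neg x ⊓ nabla x) ⊔ (x ⊓ nabla x) := by rw [inf_sup_left, hax2]
      _ ≤ nabla x := sup_le inf_le_right inf_le_right
  have neg_nabla_le : neg (nabla x) ≤ neg x := by
    have h := hdm x (nabla x)
    rw [sup_eq_right.2 le_nabla] at h
    exact h ▸ inf_le_left
  have inf_neg_nabla : x ⊓ neg (nabla x) = nabla x ⊓ neg (nabla x) := by
    refine le_antisymm (inf_le_inf_right _ le_nabla) (le_inf ?_ inf_le_right)
    calc nabla x ⊓ neg (nabla x) ≤ neg x ⊓ nabla x :=
          le_inf (inf_le_right.trans neg_nabla_le) inf_le_left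
      _ = x ⊓ neg x := (hax2 x).symm
      _ ≤ x := inf_le_left
  have nabla_fixed : nabla (nabla x ⊓ neg (nabla x)) = nabla x ⊓ neg (nabla x) := by
    have h := hax2 (neg (nabla x))
    rw [hinv] at h
    rw [← inf_neg_nabla, hax3, ← h, inf_comm, inf_neg_nabla]
  have neg_inf : neg (nabla x ⊓ neg (nabla x)) = nabla x ⊔ neg (nabla x) := by
    have h := hdm (neg (nabla x)) (nabla x)
    rw [hinv] at h
    rw [← h, hinv, sup_comm]
  have sup_eq : nabla x ⊔ neg (nabla x) = ⊤ := by
    have h := hax1 (nabla x ⊓ neg (nabla x))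
    rwa [nabla_fixed, neg_inf, sup_eq_left.2 (inf_le_left.trans le_sup_left)] at h
  refine IsCompl.of_eq ?_ sup_eq
  rw [← hinv (nabla x ⊓ neg (nabla x)), neg_inf, sup_eq, neg_top]

/-- Claim (1) in the proof of Theorem 3.2: `M s(∇x) = s(∇x)`. -/
theorem lukasiewicz_claim1 {A : Type*} [DistribLattice A] [BoundedOrder A]
    (neg nabla : A → A)
    (hinv : ∀ x : A, neg (neg x) = x)
    (hdm : ∀ x y : A, neg (x ⊔ y) = neg x ⊓ neg y)
    (hax1 : ∀ x : A, neg x ⊔ nabla x = ⊤)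
    (hax2 : ∀ x : A, x ⊓ neg x = neg x ⊓ nabla x)
    (hax3 : ∀ x y : A, nabla (x ⊓ y) = nabla x ⊓ nabla y)
    (R : {P : Set A // IsPrimeFilter P} → {P : Set A // IsPrimeFilter P} → Prop)
    (hR : ∀ P Q, R P Q ↔ (P.1 ⊆ Q.1 ∨ Q.1 ⊆ P.1))
    (M : Set {P : Set A // IsPrimeFilter P} → Set {P : Set A // IsPrimeFilter P})
    (hM : ∀ X, M X = {P | ∃ Q ∈ X, R P Q})
    (s : A → Set {P : Set A // IsPrimeFilter P})
    (hs : ∀ x : A, s x = {P | x ∈ P.1}) :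
    ∀ x : A, M (s (nabla x)) = s (nabla x) := by
  intro x
  have hc := isCompl_nabla_neg_nabla neg nabla hinv hdm hax1 hax2 hax3 x
  ext P
  simp only [hM, hs, hR, Set.mem_ofPred_eq]
  refine ⟨?_, fun hP => ⟨P, hP, Or.inl subset_rfl⟩⟩
  rintro ⟨Q, hQ, hPQ | hQP⟩
  · exact (P.2.mem_iff_mem_of_subset Q.2 hPQ hc).2 hQ
  · exact hQP hQ
end

section
/- (Claim (3) in the proof of Theorem 3.2) Let A be a three-valued Łukasiewicz algebra with △x = ∼∇∼x, Ob the set of prime filters of A, R the comparability relation on Ob (P R Q iff P ⊆ Q or Q ⊆ P), L X = {P ∈ Ob | ∀ Q, P R Q → Q ∈ X} for X ⊆ Ob, and s(x) = {P ∈ Ob | x ∈ P} the Stone map. Then for every x ∈ A, L s(△x) = s(△x). -/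
theorem IsPrimeFilter.top_mem_s12 {A : Type*} [DistribLattice A] [BoundedOrder A] {P : Set A}
    (hP : IsPrimeFilter P) : (⊤ : A) ∈ P := by
  obtain ⟨a, ha⟩ := hP.1
  exact hP.2.2.1 a ha ⊤ le_top

theorem IsPrimeFilter.bot_notMem_s12 {A : Type*} [DistribLattice A] [BoundedOrder A] {P : Set A}
    (hP : IsPrimeFilter P) : (⊥ : A) ∉ P :=
  fun h => hP.2.1 (Set.eq_univ_of_forall fun y => hP.2.2.1 ⊥ h y bot_le)

/-- Comparable prime filters contain the same complemented elements. -/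
theorem IsPrimeFilter.mem_of_isCompl_of_comparable {A : Type*} [DistribLattice A] [BoundedOrder A]
    {P Q : Set A} (hP : IsPrimeFilter P) (hQ : IsPrimeFilter Q) (h : P ⊆ Q ∨ Q ⊆ P)
    {a b : A} (hab : IsCompl a b) (ha : a ∈ P) : a ∈ Q := by
  rcases h with h | h
  · exact h ha
  · refine (hQ.2.2.2.2 a b (hab.sup_eq_top ▸ hQ.top_mem_s12)).resolve_right fun hb => ?_
    exact hP.bot_notMem_s12 (hab.inf_eq_bot ▸ hP.2.2.2.1 a ha b (h hb))

/-- In a three-valued Łukasiewicz algebra, `∼∇y` is a complement of `∇y`. -/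
theorem isCompl_neg_nabla {A : Type*} [DistribLattice A] [BoundedOrder A]
    (neg nabla : A → A)
    (hinv : ∀ x : A, neg (neg x) = x)
    (hdm : ∀ x y : A, neg (x ⊔ y) = neg x ⊓ neg y)
    (hax1 : ∀ x : A, neg x ⊔ nabla x = ⊤)
    (hax2 : ∀ x : A, x ⊓ neg x = neg x ⊓ nabla x)
    (hax3 : ∀ x y : A, nabla (x ⊓ y) = nabla x ⊓ nabla y) (y : A) :
    IsCompl (neg (nabla y)) (nabla y) := by
  have neg_top : neg ⊤ = ⊥ := by
    have h := hdm ⊤ (neg ⊥)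
    rwa [top_sup_eq, hinv, inf_bot_eq] at h
  have neg_bot : neg ⊥ = ⊤ := by rw [← neg_top, hinv]
  have nabla_bot : nabla ⊥ = ⊥ := by
    have h := hax2 ⊥
    rw [bot_inf_eq, neg_bot, top_inf_eq] at h
    exact h.symm
  have le_nabla (z : A) : z ≤ nabla z := by
    calc z = z ⊓ (neg z ⊔ nabla z) := by rw [hax1, inf_top_eq]
      _ = neg z ⊓ nabla z ⊔ z ⊓ nabla z := by rw [inf_sup_left, hax2]
      _ ≤ nabla z := sup_le inf_le_right inf_le_right
  have inf_neg_nabla : y ⊓ neg (nabla y) = ⊥ := by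
    have h := hdm (neg y) (nabla y)
    rw [hax1, neg_top, hinv] at h
    exact h.symm
  have inf_eq : neg (nabla y) ⊓ nabla y = ⊥ := by
    rw [eq_bot_iff, inf_comm, ← nabla_bot, ← inf_neg_nabla, hax3]
    exact inf_le_inf_left _ (le_nabla _)
  refine IsCompl.of_eq inf_eq ?_
  rw [← hinv (neg (nabla y) ⊔ nabla y), hdm, hinv, inf_comm, inf_eq, neg_bot]

/-- Claim (3) in the proof of Theorem 3.2: `L s(△x) = s(△x)` where `△x = ∼∇∼x`. -/
theorem lukasiewicz_claim3 {A : Type*} [DistribLattice A] [BoundedOrder A]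
    (neg nabla : A → A)
    (hinv : ∀ x : A, neg (neg x) = x)
    (hdm : ∀ x y : A, neg (x ⊔ y) = neg x ⊓ neg y)
    (hax1 : ∀ x : A, neg x ⊔ nabla x = ⊤)
    (hax2 : ∀ x : A, x ⊓ neg x = neg x ⊓ nabla x)
    (hax3 : ∀ x y : A, nabla (x ⊓ y) = nabla x ⊓ nabla y)
    (R : {P : Set A // IsPrimeFilter P} → {P : Set A // IsPrimeFilter P} → Prop)
    (hR : ∀ P Q, R P Q ↔ (P.1 ⊆ Q.1 ∨ Q.1 ⊆ P.1))
    (L : Set {P : Set A // IsPrimeFilter P} → Set {P : Set A // IsPrimeFilter P})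
    (hL : ∀ X, L X = {P | ∀ Q, R P Q → Q ∈ X})
    (s : A → Set {P : Set A // IsPrimeFilter P})
    (hs : ∀ x : A, s x = {P | x ∈ P.1}) :
    ∀ x : A, L (s (neg (nabla (neg x)))) = s (neg (nabla (neg x))) := by
  intro x
  ext P
  simp only [hL, hs, Set.mem_ofPred_eq, hR]
  exact ⟨fun h => h P (Or.inl subset_rfl), fun h Q hPQ =>
    P.2.mem_of_isCompl_of_comparable Q.2 hPQ
      (isCompl_neg_nabla neg nabla hinv hdm hax1 hax2 hax3 (neg x)) h⟩
end

section
/- (Claim (4) in the proof of Theorem 3.2) Let A be a three-valued Łukasiewicz algebra with △x = ∼∇∼x, Ob the set of prime filters of A, R the comparability relation on Ob (P R Q iff P ⊆ Q or Q ⊆ P), L X = {P ∈ Ob | ∀ Q, P R Q → Q ∈ X} for X ⊆ Ob, and s(x) = {P ∈ Ob | x ∈ P} the Stone map. Then for every x ∈ A, L s(x) = s(△x). -/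
/-- A De Morgan involution sends meets to joins. -/
theorem deMorgan_neg_inf {A : Type*} [DistribLattice A] {neg : A → A}
    (hinv : ∀ x : A, neg (neg x) = x) (hdm : ∀ x y : A, neg (x ⊔ y) = neg x ⊓ neg y) (x y : A) :
    neg (x ⊓ y) = neg x ⊔ neg y := by
  rw [← hinv (neg x ⊔ neg y), hdm, hinv, hinv]

/-- A De Morgan involution reverses the order. -/
theorem deMorgan_neg_antitone {A : Type*} [DistribLattice A] {neg : A → A}
    (hdm : ∀ x y : A, neg (x ⊔ y) = neg x ⊓ neg y) : Antitone neg := fun x y h => by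
  rw [← sup_eq_right.2 h, hdm]
  exact inf_le_left

/-- A De Morgan involution sends `⊤` to `⊥`. -/
theorem deMorgan_neg_top {A : Type*} [DistribLattice A] [BoundedOrder A] {neg : A → A}
    (hinv : ∀ x : A, neg (neg x) = x) (hdm : ∀ x y : A, neg (x ⊔ y) = neg x ⊓ neg y) :
    neg ⊤ = ⊥ := by
  have h := deMorgan_neg_antitone hdm (le_top : neg ⊥ ≤ ⊤)
  rwa [hinv, le_bot_iff] at h

/-- `{y | ∼y ∉ P}` is a prime filter whenever `P` is. -/
theorem IsPrimeFilter.compl_preimage_neg {A : Type*} [DistribLattice A] [BoundedOrder A]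
    {neg : A → A} (hinv : ∀ x : A, neg (neg x) = x)
    (hdm : ∀ x y : A, neg (x ⊔ y) = neg x ⊓ neg y) {P : Set A} (hP : IsPrimeFilter P) :
    IsPrimeFilter {y | neg y ∉ P} := by
  obtain ⟨⟨p, hp⟩, hne, hup, hinf, hsup⟩ := hP
  obtain ⟨q, hq⟩ := (Set.ne_univ_iff_exists_notMem P).1 hne
  refine ⟨⟨neg q, by simpa [hinv] using hq⟩, ?_, ?_, ?_, ?_⟩
  · exact (Set.ne_univ_iff_exists_notMem _).2 ⟨neg p, by simpa [hinv] using hp⟩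
  · exact fun x hx y hxy hy => hx (hup _ hy _ (deMorgan_neg_antitone hdm hxy))
  · intro x hx y hy h
    rw [deMorgan_neg_inf hinv hdm] at h
    exact (hsup _ _ h).elim hx hy
  · intro x y h
    by_contra! hc
    simp only [Set.mem_ofPred_eq, not_not] at hc
    exact h (hdm x y ▸ hinf _ hc.1 _ hc.2)

section Lukasiewicz

variable {A : Type*} [DistribLattice A] [BoundedOrder A] {neg nabla : A → A}

theorem lukasiewicz_le_nabla (hax1 : ∀ x : A, neg x ⊔ nabla x = ⊤)
    (hax2 : ∀ x : A, x ⊓ neg x = neg x ⊓ nabla x) (x : A) : x ≤ nabla x := by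
  have h : x ⊓ neg x ≤ nabla x := (hax2 x).le.trans inf_le_right
  calc x = x ⊓ (neg x ⊔ nabla x) := by rw [hax1, inf_top_eq]
    _ = x ⊓ neg x ⊔ x ⊓ nabla x := inf_sup_left _ _ _
    _ ≤ nabla x := sup_le h inf_le_right

theorem lukasiewicz_nabla_nabla
    (hax1 : ∀ x : A, neg x ⊔ nabla x = ⊤) (hax2 : ∀ x : A, x ⊓ neg x = neg x ⊓ nabla x)
    (hax3 : ∀ x y : A, nabla (x ⊓ y) = nabla x ⊓ nabla y) (x : A) :
    nabla (nabla x) = nabla x := by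
  have hle := lukasiewicz_le_nabla hax1 hax2
  refine le_antisymm ?_ (hle _)
  have h : nabla (nabla x) ⊓ nabla (neg x) ≤ nabla x := by
    rw [inf_comm, ← hax3, ← hax2, hax3]
    exact inf_le_left
  have htop : nabla (neg x) ⊔ nabla x = ⊤ :=
    top_le_iff.1 ((hax1 x).ge.trans (sup_le_sup_right (hle _) _))
  calc nabla (nabla x) = nabla (nabla x) ⊓ (nabla (neg x) ⊔ nabla x) := by rw [htop, inf_top_eq]
    _ = nabla (nabla x) ⊓ nabla (neg x) ⊔ nabla (nabla x) ⊓ nabla x := inf_sup_left _ _ _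
    _ ≤ nabla x := sup_le h inf_le_right

/-- `∇x` is complemented, with complement `∼∇x`. -/
theorem lukasiewicz_isCompl_neg_nabla (hinv : ∀ x : A, neg (neg x) = x)
    (hdm : ∀ x y : A, neg (x ⊔ y) = neg x ⊓ neg y)
    (hax1 : ∀ x : A, neg x ⊔ nabla x = ⊤) (hax2 : ∀ x : A, x ⊓ neg x = neg x ⊓ nabla x)
    (hax3 : ∀ x y : A, nabla (x ⊓ y) = nabla x ⊓ nabla y) (x : A) :
    IsCompl (neg (nabla x)) (nabla x) := by
  have h : neg (nabla x) ⊔ nabla x = ⊤ := by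
    simpa only [lukasiewicz_nabla_nabla hax1 hax2 hax3] using hax1 (nabla x)
  refine IsCompl.of_eq ?_ h
  rw [← deMorgan_neg_top hinv hdm, ← h, hdm, hinv, inf_comm]

/-- `△x ≤ x`. -/
theorem lukasiewicz_delta_le (hinv : ∀ x : A, neg (neg x) = x)
    (hdm : ∀ x y : A, neg (x ⊔ y) = neg x ⊓ neg y)
    (hax1 : ∀ x : A, neg x ⊔ nabla x = ⊤)
    (hax2 : ∀ x : A, x ⊓ neg x = neg x ⊓ nabla x) (x : A) : neg (nabla (neg x)) ≤ x := by
  simpa only [hinv] using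
    deMorgan_neg_antitone hdm (lukasiewicz_le_nabla hax1 hax2 (neg x))

/-- Kleene's inequality holds in a three-valued Łukasiewicz algebra. -/
theorem lukasiewicz_kleene (hinv : ∀ x : A, neg (neg x) = x)
    (hdm : ∀ x y : A, neg (x ⊔ y) = neg x ⊓ neg y)
    (hax1 : ∀ x : A, neg x ⊔ nabla x = ⊤) (hax2 : ∀ x : A, x ⊓ neg x = neg x ⊓ nabla x)
    (hax3 : ∀ x y : A, nabla (x ⊓ y) = nabla x ⊓ nabla y) (x y : A) :
    x ⊓ neg x ≤ y ⊔ neg y := by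
  have hanti := deMorgan_neg_antitone hdm
  have hdelta_sup (a b : A) :
      neg (nabla (neg (a ⊔ b))) = neg (nabla (neg a)) ⊔ neg (nabla (neg b)) := by
    rw [hdm, hax3, deMorgan_neg_inf hinv hdm]
  have hdelta_bot : neg (nabla (neg (x ⊓ neg x))) = ⊥ := by
    have hmono : neg (nabla (neg (x ⊓ neg x))) ≤ neg (nabla (neg x)) := by
      conv_rhs => rw [← sup_eq_left.2 (inf_le_left : x ⊓ neg x ≤ x), hdelta_sup]
      exact le_sup_right
    have hdisj : neg (nabla (neg x)) ⊓ neg x = ⊥ := by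
      rw [← hdm, sup_comm, ← deMorgan_neg_top hinv hdm, ← hax1 (neg x), hinv]
    exact le_bot_iff.1 (hdisj ▸ le_inf hmono
      ((lukasiewicz_delta_le hinv hdm hax1 hax2 _).trans inf_le_right))
  have hle_delta (u : A) : u ≤ neg u ⊔ neg (nabla (neg u)) := by
    have h := hax2 (neg u)
    rw [hinv] at h
    rw [← deMorgan_neg_inf hinv hdm, ← h, deMorgan_neg_inf hinv hdm, hinv]
    exact le_sup_left
  have hw : neg (y ⊔ neg y) ≤ y ⊔ neg y := by
    rw [hdm, hinv]
    exact inf_le_right.trans le_sup_left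
  refine le_sup_left.trans ((hle_delta (x ⊓ neg x ⊔ (y ⊔ neg y))).trans (sup_le ?_ ?_))
  · exact (hanti le_sup_right).trans hw
  · rw [hdelta_sup, hdelta_bot, bot_sup_eq]
    exact lukasiewicz_delta_le hinv hdm hax1 hax2 _

end Lukasiewicz

/-- Claim (4) in the proof of Theorem 3.2: `L s(x) = s(△x)` where `△x = ∼∇∼x`. -/
theorem lukasiewicz_claim4 {A : Type*} [DistribLattice A] [BoundedOrder A]
    (neg nabla : A → A)
    (hinv : ∀ x : A, neg (neg x) = x)
    (hdm : ∀ x y : A, neg (x ⊔ y) = neg x ⊓ neg y)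
    (hax1 : ∀ x : A, neg x ⊔ nabla x = ⊤)
    (hax2 : ∀ x : A, x ⊓ neg x = neg x ⊓ nabla x)
    (hax3 : ∀ x y : A, nabla (x ⊓ y) = nabla x ⊓ nabla y)
    (R : {P : Set A // IsPrimeFilter P} → {P : Set A // IsPrimeFilter P} → Prop)
    (hR : ∀ P Q, R P Q ↔ (P.1 ⊆ Q.1 ∨ Q.1 ⊆ P.1))
    (L : Set {P : Set A // IsPrimeFilter P} → Set {P : Set A // IsPrimeFilter P})
    (hL : ∀ X, L X = {P | ∀ Q, R P Q → Q ∈ X})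
    (s : A → Set {P : Set A // IsPrimeFilter P})
    (hs : ∀ x : A, s x = {P | x ∈ P.1}) :
    ∀ x : A, L (s x) = s (neg (nabla (neg x))) := by
  intro x
  have hcompl := lukasiewicz_isCompl_neg_nabla hinv hdm hax1 hax2 hax3 (neg x)
  have hdelta := lukasiewicz_delta_le hinv hdm hax1 hax2 x
  ext ⟨P, hP⟩
  simp only [hL, hs, hR, Set.mem_ofPred_eq]
  have hbot : ⊥ ∉ P := fun h =>
    hP.2.1 (Set.eq_univ_of_forall fun y => hP.2.2.1 _ h y bot_le)
  have mem_or {Q : Set A} (hQ : IsPrimeFilter Q) :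
      neg (nabla (neg x)) ∈ Q ∨ nabla (neg x) ∈ Q := by
    obtain ⟨q, hq⟩ := hQ.1
    exact hQ.2.2.2.2 _ _ (hcompl.sup_eq_top ▸ hQ.2.2.1 q hq ⊤ le_top)
  constructor
  · intro h
    have hxP : x ∈ P := h ⟨P, hP⟩ (Or.inl subset_rfl)
    refine (mem_or hP).resolve_right fun hn => ?_
    have hmem : x ⊓ neg x ∈ P := by
      have heq := hax2 (neg x)
      rw [hinv] at heq
      rw [inf_comm, heq]
      exact hP.2.2.2.1 _ hxP _ hn
    refine h ⟨_, hP.compl_preimage_neg hinv hdm⟩ (Or.inr fun y hy => ?_)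
      (hP.2.2.1 _ hmem _ inf_le_right)
    exact (hP.2.2.2.2 _ _ (hP.2.2.1 _ hmem _
      (lukasiewicz_kleene hinv hdm hax1 hax2 hax3 x y))).resolve_right hy
  · rintro h ⟨Q, hQ⟩ (hPQ | hQP)
    · exact hQ.2.2.1 _ (hPQ h) _ hdelta
    · refine hQ.2.2.1 _ ((mem_or hQ).resolve_right fun hn => hbot ?_) _ hdelta
      exact hcompl.inf_eq_bot ▸ hP.2.2.2.1 _ h _ (hQP hn)
end

section
/- (Monteiro meet identities) Let Ob be a type with an equivalence relation R, and M, L the upper and lower approximation operators. For A, B ⊆ Ob define A ⊙ B = M A ∩ B ∩ (A ∪ M (Bᶜ)). Then for all A, B ⊆ Ob: M (A ⊙ B) = M A ∩ M B and L (A ⊙ B) = L A ∩ L B. -/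
/-- Monteiro meet identities: with `A ⊙ B = M A ∩ B ∩ (A ∪ M Bᶜ)` one has
`M (A ⊙ B) = M A ∩ M B` and `L (A ⊙ B) = L A ∩ L B`. -/
theorem monteiro_meet_identities {Ob : Type*} (R : Ob → Ob → Prop) (hR : Equivalence R)
    (M L : Set Ob → Set Ob)
    (hM : ∀ A : Set Ob, M A = {z | ∃ x ∈ A, R z x})
    (hL : ∀ A : Set Ob, L A = {z | ∀ y, R z y → y ∈ A})
    (mmeet : Set Ob → Set Ob → Set Ob)
    (hmmeet : ∀ A B : Set Ob, mmeet A B = M A ∩ B ∩ (A ∪ M Bᶜ)) :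
    ∀ A B : Set Ob, M (mmeet A B) = M A ∩ M B ∧ L (mmeet A B) = L A ∩ L B := by
  intro A B
  simp only [hmmeet, hM, hL]
  constructor
  · ext z
    constructor
    · rintro ⟨x, ⟨⟨⟨a, ha, hxa⟩, hxB⟩, -⟩, hzx⟩
      exact ⟨⟨a, ha, hR.trans hzx hxa⟩, x, hxB, hzx⟩
    · rintro ⟨⟨a, ha, hza⟩, b, hb, hzb⟩
      by_cases haB : a ∈ B
      · exact ⟨a, ⟨⟨⟨a, ha, hR.refl a⟩, haB⟩, Or.inl ha⟩, hza⟩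
      · have hba : R b a := hR.trans (hR.symm hzb) hza
        exact ⟨b, ⟨⟨⟨a, ha, hba⟩, hb⟩, Or.inr ⟨a, haB, hba⟩⟩, hzb⟩
  · ext z
    constructor
    · intro h
      refine ⟨fun y hy => ?_, fun y hy => (h y hy).1.2⟩
      rcases (h y hy).2 with hyA | ⟨c, hcB, hyc⟩
      · exact hyA
      · exact absurd (h c (hR.trans hy hyc)).1.2 hcB
    · rintro ⟨hA, hB⟩ y hy
      exact ⟨⟨⟨y, hA y hy, hR.refl y⟩, hB y hy⟩, Or.inl (hA y hy)⟩
end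

section
/- (Monteiro join identities) Let Ob be a type with an equivalence relation R, and M, L the upper and lower approximation operators. For A, B ⊆ Ob define A ⊎ B = L A ∪ B ∪ (A ∩ L (Bᶜ)). Then for all A, B ⊆ Ob: M (A ⊎ B) = M A ∪ M B and L (A ⊎ B) = L A ∪ L B. -/
/-- Monteiro join identities: with `A ⊎ B = L A ∪ B ∪ (A ∩ L Bᶜ)` one has
`M (A ⊎ B) = M A ∪ M B` and `L (A ⊎ B) = L A ∪ L B`. -/
theorem monteiro_join_identities {Ob : Type*} (R : Ob → Ob → Prop) (hR : Equivalence R)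
    (M L : Set Ob → Set Ob)
    (hM : ∀ A : Set Ob, M A = {z | ∃ x ∈ A, R z x})
    (hL : ∀ A : Set Ob, L A = {z | ∀ y, R z y → y ∈ A})
    (mjoin : Set Ob → Set Ob → Set Ob)
    (hmjoin : ∀ A B : Set Ob, mjoin A B = L A ∪ B ∪ (A ∩ L Bᶜ)) :
    ∀ A B : Set Ob, M (mjoin A B) = M A ∪ M B ∧ L (mjoin A B) = L A ∪ L B := by
  intro A B
  have mem_L : ∀ {X : Set Ob} {z : Ob}, z ∈ L X ↔ ∀ y, R z y → y ∈ X := by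
    intro X z
    rw [hL, Set.mem_ofPred_eq]
  have mem_L_of_rel : ∀ {X : Set Ob} {z y : Ob}, R z y → y ∈ L X → z ∈ L X := fun h hy ↦
    mem_L.2 fun w hw ↦ mem_L.1 hy w (hR.trans (hR.symm h) hw)
  have mem_of_mem_L : ∀ {X : Set Ob} {z : Ob}, z ∈ L X → z ∈ X := fun h ↦ mem_L.1 h _ (hR.refl _)
  constructor
  · simp only [hM, hmjoin]
    ext z
    constructor
    · rintro ⟨x, (hx | hx) | hx, hzx⟩
      · exact Or.inl ⟨x, mem_of_mem_L hx, hzx⟩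
      · exact Or.inr ⟨x, hx, hzx⟩
      · exact Or.inl ⟨x, hx.1, hzx⟩
    · rintro (⟨x, hx, hzx⟩ | ⟨x, hx, hzx⟩)
      · by_cases h : ∃ b ∈ B, R z b
        · obtain ⟨b, hb, hzb⟩ := h
          exact ⟨b, Or.inl (Or.inr hb), hzb⟩
        · exact ⟨x, Or.inr ⟨hx, mem_L.2 fun y hxy hy ↦ h ⟨y, hy, hR.trans hzx hxy⟩⟩, hzx⟩
      · exact ⟨x, Or.inl (Or.inr hx), hzx⟩
  · ext z
    rw [hmjoin]
    constructor
    · intro hz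
      by_cases hzA : z ∈ L A
      · exact Or.inl hzA
      by_cases h : ∃ b ∈ B, R z b
      · obtain ⟨b, hb, hzb⟩ := h
        refine Or.inr (mem_L.2 fun y hzy ↦ ?_)
        rcases mem_L.1 hz y hzy with (hy | hy) | hy
        · exact absurd (mem_L_of_rel hzy hy) hzA
        · exact hy
        · exact absurd hb (mem_L.1 hy.2 b (hR.trans (hR.symm hzy) hzb))
      · refine Or.inl (mem_L.2 fun y hzy ↦ ?_)
        rcases mem_L.1 hz y hzy with (hy | hy) | hy
        · exact mem_of_mem_L hy
        · exact absurd ⟨y, hy, hzy⟩ h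
        · exact hy.1
    · rintro (hz | hz)
      · exact mem_L.2 fun y hzy ↦ Or.inl (Or.inl (mem_L_of_rel (hR.symm hzy) hz))
      · exact mem_L.2 fun y hzy ↦ Or.inl (Or.inr (mem_L.1 hz y hzy))
end

section
/- (The rough-equality relation is a congruence) Let Ob be a type with an equivalence relation R, M and L the upper and lower approximation operators, A ⊙ B = M A ∩ B ∩ (A ∪ M (Bᶜ)) and A ⊎ B = L A ∪ B ∪ (A ∩ L (Bᶜ)). Define A ≡ A' iff L A = L A' and M A = M A'. Then ≡ is an equivalence relation on Set Ob and is a congruence for ⊙, ⊎, complement and M: if A ≡ A' and B ≡ B', then A ⊙ B ≡ A' ⊙ B', A ⊎ B ≡ A' ⊎ B', Aᶜ ≡ A'ᶜ, and M A ≡ M A'. -/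
namespace RoughSet

variable {Ob : Type*} (R : Ob → Ob → Prop)

/-- The upper approximation of `A`. -/
def upper (A : Set Ob) : Set Ob := {z | ∃ x ∈ A, R z x}

/-- The lower approximation of `A`. -/
def lower (A : Set Ob) : Set Ob := {z | ∀ y, R z y → y ∈ A}

/-- The Monteiro meet of `A` and `B`. -/
def meet (A B : Set Ob) : Set Ob := upper R A ∩ B ∩ (A ∪ upper R Bᶜ)

/-- The Monteiro join of `A` and `B`. -/
def join (A B : Set Ob) : Set Ob := lower R A ∪ B ∪ (A ∩ lower R Bᶜ)

theorem upper_compl (A : Set Ob) : upper R Aᶜ = (lower R A)ᶜ := by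
  ext z
  simp [upper, lower, and_comm]

theorem lower_compl (A : Set Ob) : lower R Aᶜ = (upper R A)ᶜ := by
  rw [← compl_compl (lower R Aᶜ), ← upper_compl, compl_compl]

theorem compl_meet_compl (A B : Set Ob) : (meet R Aᶜ Bᶜ)ᶜ = join R A B := by
  simp only [meet, join, Set.compl_inter, Set.compl_union, upper_compl, lower_compl, compl_compl]

variable {R}

theorem mem_upper_iff_of_rel (hR : Equivalence R) {x y : Ob} (h : R x y) (A : Set Ob) :
    x ∈ upper R A ↔ y ∈ upper R A :=
  ⟨fun ⟨a, ha, hxa⟩ => ⟨a, ha, hR.trans (hR.symm h) hxa⟩,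
    fun ⟨a, ha, hya⟩ => ⟨a, ha, hR.trans h hya⟩⟩

theorem upper_upper (hR : Equivalence R) (A : Set Ob) : upper R (upper R A) = upper R A :=
  Set.ext fun x => ⟨fun ⟨_, hy, hxy⟩ => (mem_upper_iff_of_rel hR hxy A).2 hy,
    fun hx => ⟨x, hx, hR.refl x⟩⟩

theorem lower_upper (hR : Equivalence R) (A : Set Ob) : lower R (upper R A) = upper R A :=
  Set.ext fun x => ⟨fun h => h x (hR.refl x),
    fun hx _ hxy => (mem_upper_iff_of_rel hR hxy A).1 hx⟩

theorem upper_meet (hR : Equivalence R) (A B : Set Ob) :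
    upper R (meet R A B) = upper R A ∩ upper R B := by
  ext x
  constructor
  · rintro ⟨y, ⟨⟨hyA, hyB⟩, -⟩, hxy⟩
    exact ⟨(mem_upper_iff_of_rel hR hxy A).2 hyA, y, hyB, hxy⟩
  · rintro ⟨hxA, b, hb, hxb⟩
    by_cases hx : x ∈ upper R Bᶜ
    · exact ⟨b, ⟨⟨(mem_upper_iff_of_rel hR hxb A).1 hxA, hb⟩,
        Or.inr ((mem_upper_iff_of_rel hR hxb Bᶜ).1 hx)⟩, hxb⟩
    · obtain ⟨a, ha, hxa⟩ := hxA
      exact ⟨a, ⟨⟨⟨a, ha, hR.refl a⟩, by_contra fun haB => hx ⟨a, haB, hxa⟩⟩, Or.inl ha⟩, hxa⟩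

theorem lower_meet (hR : Equivalence R) (A B : Set Ob) :
    lower R (meet R A B) = lower R A ∩ lower R B := by
  ext x
  constructor
  · intro h
    refine ⟨fun y hxy => (h y hxy).2.resolve_right ?_, fun y hxy => (h y hxy).1.2⟩
    rintro ⟨z, hzB, hyz⟩
    exact hzB (h z (hR.trans hxy hyz)).1.2
  · rintro ⟨hA, hB⟩ y hxy
    exact ⟨⟨⟨y, hA y hxy, hR.refl y⟩, hB y hxy⟩, Or.inl (hA y hxy)⟩

theorem upper_join (hR : Equivalence R) (A B : Set Ob) :
    upper R (join R A B) = upper R A ∪ upper R B := by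
  rw [← compl_meet_compl, upper_compl, lower_meet hR, lower_compl, lower_compl,
    Set.compl_inter, compl_compl, compl_compl]

theorem lower_join (hR : Equivalence R) (A B : Set Ob) :
    lower R (join R A B) = lower R A ∪ lower R B := by
  rw [← compl_meet_compl, lower_compl, upper_meet hR, upper_compl, upper_compl,
    Set.compl_inter, compl_compl, compl_compl]

end RoughSet

/-- The rough-equality relation `A ≡ B ↔ L A = L B ∧ M A = M B` is an equivalence
relation and a congruence for the Monteiro operations `⊙`, `⊎`, complement and `M`. -/
theorem rough_equality_congruence {Ob : Type*} (R : Ob → Ob → Prop) (hR : Equivalence R)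
    (M L : Set Ob → Set Ob)
    (hM : ∀ A : Set Ob, M A = {z | ∃ x ∈ A, R z x})
    (hL : ∀ A : Set Ob, L A = {z | ∀ y, R z y → y ∈ A})
    (mmeet mjoin : Set Ob → Set Ob → Set Ob)
    (hmmeet : ∀ A B : Set Ob, mmeet A B = M A ∩ B ∩ (A ∪ M Bᶜ))
    (hmjoin : ∀ A B : Set Ob, mjoin A B = L A ∪ B ∪ (A ∩ L Bᶜ))
    (req : Set Ob → Set Ob → Prop)
    (hreq : ∀ A B : Set Ob, req A B ↔ (L A = L B ∧ M A = M B)) :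
    Equivalence req ∧
    (∀ A A' B B' : Set Ob, req A A' → req B B' →
      req (mmeet A B) (mmeet A' B') ∧
      req (mjoin A B) (mjoin A' B') ∧
      req Aᶜ A'ᶜ ∧
      req (M A) (M A')) := by
  obtain rfl : M = RoughSet.upper R := funext hM
  obtain rfl : L = RoughSet.lower R := funext hL
  obtain rfl : mmeet = RoughSet.meet R := funext₂ hmmeet
  obtain rfl : mjoin = RoughSet.join R := funext₂ hmjoin
  simp only [hreq]
  refine ⟨⟨fun A => ?_, fun {A B} h => ?_, fun {A B C} h h' => ?_⟩, ?_⟩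
  · simp only [hreq, and_self]
  · rw [hreq] at h ⊢
    exact ⟨h.1.symm, h.2.symm⟩
  · rw [hreq] at h h' ⊢
    exact ⟨h.1.trans h'.1, h.2.trans h'.2⟩
  · rintro A A' B B' ⟨hlA, huA⟩ ⟨hlB, huB⟩
    simp only [RoughSet.lower_meet hR, RoughSet.upper_meet hR, RoughSet.lower_join hR,
      RoughSet.upper_join hR, RoughSet.lower_compl, RoughSet.upper_compl,
      RoughSet.lower_upper hR, RoughSet.upper_upper hR, hlA, huA, hlB, huB, and_self]
end

section
/- (Proposition 4.1, join case) Let Ob be a type with an equivalence relation R, M and L the upper and lower approximation operators, and A ⊎ B = L A ∪ B ∪ (A ∩ L (Bᶜ)). For A ⊆ Ob define the membership function μ_A : Ob → ℚ by μ_A(x) = 1 if x ∈ L A, μ_A(x) = 1/2 if x ∈ M A ∩ (L A)ᶜ, and μ_A(x) = 0 if x ∈ (M A)ᶜ. Then for all A, B ⊆ Ob and all x ∈ Ob: μ_{A ⊎ B}(x) = max(μ_A(x), μ_B(x)). -/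
open Classical

/-- The lower approximation sends the Monteiro join to the union. -/
theorem lower_join_iff {Ob : Type*} {R : Ob → Ob → Prop} (hR : Equivalence R)
    {L : Set Ob → Set Ob} (hL : ∀ A : Set Ob, L A = {z | ∀ y, R z y → y ∈ A})
    (A B : Set Ob) (x : Ob) :
    x ∈ L (L A ∪ B ∪ (A ∩ L Bᶜ)) ↔ x ∈ L A ∨ x ∈ L B := by
  have mem_L (C : Set Ob) (z : Ob) : z ∈ L C ↔ ∀ y, R z y → y ∈ C := by rw [hL]; rfl
  have L_congr (C : Set Ob) {y z : Ob} (h : R y z) (hy : y ∈ L C) : z ∈ L C :=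
    (mem_L C z).2 fun w hw => (mem_L C y).1 hy w (hR.trans h hw)
  rw [mem_L]
  constructor
  · intro h
    by_contra! ⟨hA, hB⟩
    have notMem_LA {y : Ob} (hy : R x y) : y ∉ L A := fun h' => hA (L_congr A (hR.symm hy) h')
    refine hB ((mem_L B x).2 fun y hy => ?_)
    rcases h y hy with (hyA | hyB) | ⟨-, hyB⟩
    · exact absurd hyA (notMem_LA hy)
    · exact hyB
    · refine absurd ((mem_L A x).2 fun z hz => ?_) hA
      rcases h z hz with (hzA | hzB) | ⟨hzA, -⟩
      · exact absurd hzA (notMem_LA hz)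
      · exact absurd hzB ((mem_L Bᶜ y).1 hyB z (hR.trans (hR.symm hy) hz))
      · exact hzA
  · rintro (h | h) y hy
    · exact Or.inl (Or.inl (L_congr A hy h))
    · exact Or.inl (Or.inr ((mem_L B x).1 h y hy))

/-- The upper approximation sends the Monteiro join to the union. -/
theorem upper_join_iff {Ob : Type*} {R : Ob → Ob → Prop} (hR : Equivalence R)
    {M L : Set Ob → Set Ob} (hM : ∀ A : Set Ob, M A = {z | ∃ x ∈ A, R z x})
    (hL : ∀ A : Set Ob, L A = {z | ∀ y, R z y → y ∈ A}) (A B : Set Ob) (x : Ob) :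
    x ∈ M (L A ∪ B ∪ (A ∩ L Bᶜ)) ↔ x ∈ M A ∨ x ∈ M B := by
  have mem_L (C : Set Ob) (z : Ob) : z ∈ L C ↔ ∀ y, R z y → y ∈ C := by rw [hL]; rfl
  have mem_M (C : Set Ob) (z : Ob) : z ∈ M C ↔ ∃ y ∈ C, R z y := by rw [hM]; rfl
  simp only [mem_M]
  constructor
  · rintro ⟨y, (hyA | hyB) | ⟨hyA, -⟩, hy⟩
    · exact Or.inl ⟨y, (mem_L A y).1 hyA y (hR.refl y), hy⟩
    · exact Or.inr ⟨y, hyB, hy⟩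
    · exact Or.inl ⟨y, hyA, hy⟩
  · rintro (⟨y, hyA, hy⟩ | ⟨y, hyB, hy⟩)
    · by_cases h : ∃ z ∈ B, R x z
      · obtain ⟨z, hzB, hz⟩ := h
        exact ⟨z, Or.inl (Or.inr hzB), hz⟩
      · exact ⟨y, Or.inr ⟨hyA, (mem_L Bᶜ y).2 fun z hz hzB =>
          h ⟨z, hzB, hR.trans hy hz⟩⟩, hy⟩
    · exact ⟨y, Or.inl (Or.inr hyB), hy⟩

/-- Proposition 4.1, join case: the membership function extends the Monteiro join,
`μ_{A ⊎ B}(x) = max(μ_A(x), μ_B(x))`. -/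
theorem membership_join {Ob : Type*} (R : Ob → Ob → Prop) (hR : Equivalence R)
    (M L : Set Ob → Set Ob)
    (hM : ∀ A : Set Ob, M A = {z | ∃ x ∈ A, R z x})
    (hL : ∀ A : Set Ob, L A = {z | ∀ y, R z y → y ∈ A})
    (mjoin : Set Ob → Set Ob → Set Ob)
    (hmjoin : ∀ A B : Set Ob, mjoin A B = L A ∪ B ∪ (A ∩ L Bᶜ))
    (μ : Set Ob → Ob → ℚ)
    (hμ : ∀ (A : Set Ob) (x : Ob),
      μ A x = if x ∈ L A then 1 else if x ∈ M A then 1/2 else 0) :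
    ∀ (A B : Set Ob) (x : Ob), μ (mjoin A B) x = max (μ A x) (μ B x) := by
  intro A B x
  simp only [hμ, hmjoin, lower_join_iff hR hL, upper_join_iff hR hM hL]
  by_cases hLA : x ∈ L A <;> by_cases hLB : x ∈ L B <;>
    by_cases hMA : x ∈ M A <;> by_cases hMB : x ∈ M B <;>
    simp only [hLA, hLB, hMA, hMB, or_true, true_or, or_self, if_true, if_false] <;> norm_num
end

section
/- (Proposition 4.1, meet and negation cases) Let Ob be a type with an equivalence relation R, M and L the upper and lower approximation operators, and A ⊙ B = M A ∩ B ∩ (A ∪ M (Bᶜ)). For A ⊆ Ob define the membership function μ_A : Ob → ℚ by μ_A(x) = 1 if x ∈ L A, μ_A(x) = 1/2 if x ∈ M A ∩ (L A)ᶜ, and μ_A(x) = 0 if x ∈ (M A)ᶜ. Then for all A, B ⊆ Ob and all x ∈ Ob: μ_{A ⊙ B}(x) = min(μ_A(x), μ_B(x)) and μ_{Aᶜ}(x) = 1 − μ_A(x). -/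
open Classical

/-- Proposition 4.1, meet and negation cases: the membership function extends the
Monteiro meet and complement: `μ_{A ⊙ B}(x) = min(μ_A(x), μ_B(x))` and
`μ_{Aᶜ}(x) = 1 - μ_A(x)`. -/
theorem membership_meet_neg {Ob : Type*} (R : Ob → Ob → Prop) (hR : Equivalence R)
    (M L : Set Ob → Set Ob)
    (hM : ∀ A : Set Ob, M A = {z | ∃ x ∈ A, R z x})
    (hL : ∀ A : Set Ob, L A = {z | ∀ y, R z y → y ∈ A})
    (mmeet : Set Ob → Set Ob → Set Ob)
    (hmmeet : ∀ A B : Set Ob, mmeet A B = M A ∩ B ∩ (A ∪ M Bᶜ))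
    (μ : Set Ob → Ob → ℚ)
    (hμ : ∀ (A : Set Ob) (x : Ob),
      μ A x = if x ∈ L A then 1 else if x ∈ M A then 1/2 else 0) :
    ∀ (A B : Set Ob) (x : Ob),
      μ (mmeet A B) x = min (μ A x) (μ B x) ∧ μ Aᶜ x = 1 - μ A x := by
  intro A B x
  have memL (A : Set Ob) (z : Ob) : z ∈ L A ↔ ∀ y, R z y → y ∈ A := by simp [hL]
  have memM (A : Set Ob) (z : Ob) : z ∈ M A ↔ ∃ y ∈ A, R z y := by simp [hM]
  have lower_compl : x ∈ L Aᶜ ↔ x ∉ M A := by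
    simp only [memL, memM, Set.mem_compl_iff]
    grind
  have upper_compl (A : Set Ob) (z : Ob) : z ∈ M Aᶜ ↔ z ∉ L A := by
    simp only [memL, memM, Set.mem_compl_iff]
    grind
  have lower_le_upper (A : Set Ob) (h : x ∈ L A) : x ∈ M A :=
    (memM A x).2 ⟨x, (memL A x).1 h x (hR.refl x), hR.refl x⟩
  have lower_congr {A : Set Ob} {y : Ob} (h : R x y) : y ∈ L A ↔ x ∈ L A := by
    simp only [memL]
    exact ⟨fun H w hw => H w (hR.trans (hR.symm h) hw), fun H w hw => H w (hR.trans h hw)⟩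
  have upper_congr {A : Set Ob} {y : Ob} (h : R x y) : y ∈ M A ↔ x ∈ M A := by
    simp only [memM]
    exact ⟨fun ⟨w, hw, hyw⟩ => ⟨w, hw, hR.trans h hyw⟩,
      fun ⟨w, hw, hxw⟩ => ⟨w, hw, hR.trans (hR.symm h) hxw⟩⟩
  have mem_meet {y : Ob} (h : R x y) :
      y ∈ mmeet A B ↔ x ∈ M A ∧ y ∈ B ∧ (y ∈ A ∨ x ∉ L B) := by
    simp only [hmmeet, Set.mem_inter_iff, Set.mem_union, upper_compl, lower_congr h,
      upper_congr h, and_assoc]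
  have lower_meet : x ∈ L (mmeet A B) ↔ x ∈ L A ∧ x ∈ L B := by
    constructor
    · intro h
      have key (y : Ob) (hy : R x y) := (mem_meet hy).1 ((memL _ x).1 h y hy)
      have hB : x ∈ L B := (memL B x).2 fun y hy => (key y hy).2.1
      exact ⟨(memL A x).2 fun y hy => (key y hy).2.2.resolve_right (not_not.2 hB), hB⟩
    · rintro ⟨hA, hB⟩
      exact (memL _ x).2 fun y hy => (mem_meet hy).2
        ⟨lower_le_upper A hA, (memL B x).1 hB y hy, Or.inl ((memL A x).1 hA y hy)⟩
  have upper_meet : x ∈ M (mmeet A B) ↔ x ∈ M A ∧ x ∈ M B := by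
    constructor
    · intro h
      obtain ⟨y, hy, hxy⟩ := (memM _ x).1 h
      obtain ⟨hA, hB, -⟩ := (mem_meet hxy).1 hy
      exact ⟨hA, (memM B x).2 ⟨y, hB, hxy⟩⟩
    · rintro ⟨hA, hB⟩
      by_cases hLB : x ∈ L B
      · obtain ⟨y, hy, hxy⟩ := (memM A x).1 hA
        exact (memM _ x).2 ⟨y, (mem_meet hxy).2 ⟨hA, (memL B x).1 hLB y hxy, Or.inl hy⟩, hxy⟩
      · obtain ⟨y, hy, hxy⟩ := (memM B x).1 hB
        exact (memM _ x).2 ⟨y, (mem_meet hxy).2 ⟨hA, hy, Or.inr hLB⟩, hxy⟩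
  have hA := lower_le_upper A
  have hB := lower_le_upper B
  simp only [hμ, lower_meet, upper_meet, lower_compl, upper_compl]
  by_cases hLA : x ∈ L A <;> by_cases hMA : x ∈ M A <;>
    by_cases hLB : x ∈ L B <;> by_cases hMB : x ∈ M B <;>
    simp_all only [not_true_eq_false, imp_false, true_and, false_and, and_true, and_false,
      not_false_eq_true, if_true, if_false] <;> norm_num
end
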